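/- arXiv:2301.13533 — 2 statements merged into one kernel-verified Lean document; each statement's English description precedes it below -/
import Mathlib

section
/- Let N ∈ ℕ, τ ≥ 0, and k_p, k_i > 0. Let x : ℝ → ℝ^N be differentiable and u : ℝ → ℝ^N be such that x'(t) = −τ·x(t) + u(t) for all t, and define the output y(t) = k_i·x(t) + k_p·u(t). Then the storage function S(t) = (k_i/2)·x(t)ᵀx(t) satisfies, for all t, S'(t) = (1 + 2τ·k_p/k_i)·u(t)ᵀy(t) − (k_p + τ·k_p²/k_i)·u(t)ᵀu(t) − (τ/k_i)·y(t)ᵀy(t). -/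
open Matrix

/-- The derivative of `t ↦ xᵀx` is `2 xᵀẋ`. -/
theorem HasDerivAt.dotProduct_self {ι : Type*} [Fintype ι] {x : ℝ → ι → ℝ} {x' : ι → ℝ} {t : ℝ}
    (hx : HasDerivAt x x' t) :
    HasDerivAt (fun s => x s ⬝ᵥ x s) (2 * (x t ⬝ᵥ x')) t := by
  have h : HasDerivAt (fun s => ∑ i, x s i * x s i) (∑ i, (x' i * x t i + x t i * x' i)) t :=
    HasDerivAt.fun_sum fun i _ => (hasDerivAt_pi.1 hx i).mul (hasDerivAt_pi.1 hx i)
  refine h.congr_deriv ?_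
  rw [dotProduct, Finset.mul_sum]
  exact Finset.sum_congr rfl fun i _ => by ring

/-- The leaky PI controller `ẋ = −τx + u`, `y = k_i x + k_p u`
satisfies the dissipation equality with supply rate
`(1 + 2τk_p/k_i)·uᵀy − (k_p + τk_p²/k_i)·uᵀu − (τ/k_i)·yᵀy`
for the storage function `S = (k_i/2)·xᵀx`. -/
theorem leaky_PI_supply (N : ℕ) (τ kp ki : ℝ) (hτ : 0 ≤ τ)
    (hkp : 0 < kp) (hki : 0 < ki)
    (x u y : ℝ → Fin N → ℝ)
    (hx : ∀ t, HasDerivAt x ((-τ) • x t + u t) t)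
    (hy : ∀ t, y t = ki • x t + kp • u t) :
    ∀ t, deriv (fun t => (ki / 2) * (x t ⬝ᵥ x t)) t
      = (1 + 2 * τ * kp / ki) * (u t ⬝ᵥ y t)
        - (kp + τ * kp ^ 2 / ki) * (u t ⬝ᵥ u t)
        - (τ / ki) * (y t ⬝ᵥ y t) := by
  intro t
  rw [((hx t).dotProduct_self.const_mul (ki / 2)).deriv, hy t]
  simp only [dotProduct_add, add_dotProduct, dotProduct_smul, smul_dotProduct, smul_eq_mul,
    dotProduct_comm (u t) (x t)]
  field_simp
  ring
end

section
/- Let a > 0, b ≥ 0, and c ≥ 0. Define the dead-zone function g_c : ℝ → ℝ by g_c(u) = u + c if u < −c, g_c(u) = 0 if −c ≤ u ≤ c, and g_c(u) = u − c if u > c, and define the weighting function h(u) = a·u + b·g_c(u) − b·tanh(g_c(u)). Then for all u, w ∈ ℝ, writing ũ = u − w and ỹ = h(u) − h(w), one has (ỹ − a·ũ)·((1/(a + b))·ỹ − ũ) ≤ 0; i.e., the arbitrarily shifted weighting function is input-feedforward output-feedback passive with indices (a, 1/(a + b)). -/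
theorem Real.hasDerivAt_tanh_one_div (x : ℝ) :
    HasDerivAt Real.tanh (1 / Real.cosh x ^ 2) x := by
  have hd := (Real.hasDerivAt_sinh x).div (Real.hasDerivAt_cosh x) (Real.cosh_pos x).ne'
  rw [show Real.tanh = Real.sinh / Real.cosh from funext Real.tanh_eq_sinh_div_cosh]
  rwa [show Real.cosh x * Real.cosh x - Real.sinh x * Real.sinh x = 1 by
    nlinarith [Real.cosh_sq x]] at hd

theorem Real.monotone_tanh : Monotone Real.tanh :=
  monotone_of_hasDerivAt_nonneg Real.hasDerivAt_tanh_one_div fun x => by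
    simp only [Pi.zero_apply]; positivity

theorem Real.monotone_sub_tanh : Monotone fun x : ℝ => x - Real.tanh x :=
  monotone_of_hasDerivAt_nonneg
    (fun x => (hasDerivAt_id x).sub (Real.hasDerivAt_tanh_one_div x)) fun x => by
      have hx : 1 / Real.cosh x ^ 2 ≤ 1 := by
        rw [div_le_one (by have := Real.cosh_pos x; positivity)]
        nlinarith [Real.one_le_cosh x]
      simpa using hx

/-- For `a > 0`, `b ≥ 0`, `c ≥ 0`, the arbitrarily shifted
weighting function `h(u) = a·u + b·g_c(u) − b·tanh(g_c(u))` is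
IFOFP`(a, 1/(a+b))`. -/
theorem weighting_function_IFOFP (a b c : ℝ)
    (ha : 0 < a) (hb : 0 ≤ b) (hc : 0 ≤ c)
    (g h : ℝ → ℝ)
    (hg : ∀ u : ℝ, g u = if u < -c then u + c else if u ≤ c then 0 else u - c)
    (hh : ∀ u : ℝ, h u = a * u + b * g u - b * Real.tanh (g u)) :
    ∀ u w : ℝ,
      ((h u - h w) - a * (u - w)) *
        ((1 / (a + b)) * (h u - h w) - (u - w)) ≤ 0 := by
  have hab : 0 < a + b := by linarith
  have g_incr : ∀ u w : ℝ, w ≤ u → 0 ≤ g u - g w ∧ g u - g w ≤ u - w := by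
    intro u w huw
    rw [hg u, hg w]
    split_ifs <;> constructor <;> linarith
  have of_le : ∀ u w : ℝ, w ≤ u →
      ((h u - h w) - a * (u - w)) * ((1 / (a + b)) * (h u - h w) - (u - w)) ≤ 0 := by
    intro u w huw
    obtain ⟨hg0, hg1⟩ := g_incr u w huw
    have hg_le : g w ≤ g u := by linarith
    have htanh := Real.monotone_tanh hg_le
    have hsub : g w - Real.tanh (g w) ≤ g u - Real.tanh (g u) := Real.monotone_sub_tanh hg_le
    rw [hh u, hh w]
    refine mul_nonpos_of_nonneg_of_nonpos ?_ ?_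
    · nlinarith [mul_nonneg hb (sub_nonneg.2 hsub)]
    · rw [sub_nonpos, one_div, inv_mul_le_iff₀ hab]
      nlinarith [mul_nonneg hb (sub_nonneg.2 hg1), mul_nonneg hb (sub_nonneg.2 htanh)]
  intro u w
  rcases le_total w u with huw | huw
  · exact of_le u w huw
  · linarith [of_le w u huw]
end
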